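/- arXiv:1607.03551 — 2 statements merged into one kernel-verified Lean document; each statement's English description precedes it below -/
import Mathlib

section
/- Let n ≥ 1 and p ≥ 1 be integers and let I ⊆ S = ℝ[x_0,…,x_n] be a homogeneous radical ideal with I_1 = 0. Suppose the p-base-point-free property holds: for every linear subspace W ⊆ S_1 of codimension at most p in S_1 whose forms have no common zero on V(I) ∖ {0}, one has S_2 ⊆ I_2 + W·S_1. Then V(I) is p-small in the following sense: for every real linear subspace L ⊆ ℝ^{n+1} of dimension at most p + 1 such that V(I) ∩ L_ℂ is a finite union of one-dimensional complex subspaces (lines through the origin), any collection of nonzero vectors containing exactly one vector from each of these lines is linearly independent over ℂ. -/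
open MvPolynomial

noncomputable section

/-- The polynomial ring `S = ℝ[x_0, …, x_n]`. -/
abbrev PolyS (n : ℕ) := MvPolynomial (Fin (n + 1)) ℝ

/-- The space `S_2` of homogeneous quadratic forms. -/
abbrev S2 (n : ℕ) : Submodule ℝ (PolyS n) := homogeneousSubmodule (Fin (n + 1)) ℝ 2

lemma sq_mem_S2 {n : ℕ} {f : PolyS n} (hf : f.IsHomogeneous 1) : f * f ∈ S2 n := by
  rw [mem_homogeneousSubmodule]
  simpa using hf.mul hf

lemma XX_mem_S2 {n : ℕ} (i j : Fin (n + 1)) : (X i : PolyS n) * X j ∈ S2 n := by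
  rw [mem_homogeneousSubmodule]
  simpa using (isHomogeneous_X ℝ i).mul (isHomogeneous_X ℝ j)

/-- `I` is a homogeneous ideal. -/
def IsHomIdeal {n : ℕ} (I : Ideal (PolyS n)) : Prop :=
  ∀ f ∈ I, ∀ d : ℕ, homogeneousComponent d f ∈ I

/-- The Hankel cone `Σ*(I)`: linear functionals on `S_2` vanishing on `I_2` whose
associated bilinear form `B_ℓ(f,g) = ℓ(f·g)` on `S_1` is positive semidefinite. -/
def SigmaStar {n : ℕ} (I : Ideal (PolyS n)) : Set (S2 n →ₗ[ℝ] ℝ) :=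
  { l | (∀ q : S2 n, (q : PolyS n) ∈ I → l q = 0) ∧
        ∀ (f : PolyS n) (hf : f.IsHomogeneous 1), 0 ≤ l ⟨f * f, sq_mem_S2 hf⟩ }

/-- The rank of the bilinear form `B_ℓ` on `S_1`, computed as the rank of its matrix
in the basis of the variables. -/
def rankL {n : ℕ} (l : S2 n →ₗ[ℝ] ℝ) : ℕ :=
  (Matrix.of fun i j : Fin (n + 1) => l ⟨X i * X j, XX_mem_S2 i j⟩).rank

/-- `l` spans an extreme ray of the convex cone `C`. -/
def IsExtremeIn {n : ℕ} (C : Set (S2 n →ₗ[ℝ] ℝ)) (l : S2 n →ₗ[ℝ] ℝ) : Prop :=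
  l ∈ C ∧ l ≠ 0 ∧ ∀ l₁ ∈ C, ∀ l₂ ∈ C, l = l₁ + l₂ →
    (∃ c : ℝ, 0 ≤ c ∧ l₁ = c • l) ∧ ∃ c : ℝ, 0 ≤ c ∧ l₂ = c • l

/-- The complex zero set `V(I) ⊆ ℂ^{n+1}`. -/
def VC {n : ℕ} (I : Ideal (PolyS n)) : Set (Fin (n + 1) → ℂ) :=
  { z | ∀ f ∈ I, aeval z f = 0 }

/-- The `p`-base-point-free property: every linear series `W ⊆ S_1` of codimension at most
`p` in `S_1` without common zeros on `V(I) ∖ {0}` satisfies `S_2 ⊆ I_2 + W·S_1`. -/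
def pBPF {n : ℕ} (I : Ideal (PolyS n)) (p : ℕ) : Prop :=
  ∀ W : Submodule ℝ (PolyS n), W ≤ homogeneousSubmodule (Fin (n + 1)) ℝ 1 →
    n + 1 ≤ Module.finrank ℝ W + p →
    (∀ z ∈ VC I, z ≠ 0 → ∃ w ∈ W, aeval z w ≠ 0) →
    ∀ q : PolyS n, q.IsHomogeneous 2 →
      ∃ a ∈ I, a.IsHomogeneous 2 ∧ q - a ∈ Ideal.span (W : Set (PolyS n))

/-- The complexification `L_ℂ ⊆ ℂ^{n+1}` of a real linear subspace `L ⊆ ℝ^{n+1}`. -/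
def complexify {n : ℕ} (L : Submodule ℝ (Fin (n + 1) → ℝ)) :
    Submodule ℂ (Fin (n + 1) → ℂ) :=
  Submodule.span ℂ ((fun (x : Fin (n + 1) → ℝ) (i : Fin (n + 1)) => (x i : ℂ)) '' L)

open scoped ComplexConjugate

lemma LinearMap.apply_eq_sum_mul_single {K κ : Type*} [Field K] [Fintype κ] [DecidableEq κ]
    (φ : (κ → K) →ₗ[K] K) (y : κ → K) : φ y = ∑ k, y k * φ (Pi.single k 1) := by
  conv_lhs => rw [pi_eq_sum_univ' y]
  simp [map_sum]

/-- The real linear form `∑ aᵢ xᵢ` with coefficient vector `a`. -/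
def linForm (n : ℕ) : (Fin (n + 1) → ℝ) →ₗ[ℝ] PolyS n :=
  Fintype.linearCombination ℝ (X : Fin (n + 1) → PolyS n)

lemma linForm_single {n : ℕ} (k : Fin (n + 1)) : linForm n (Pi.single k 1) = X k := by
  simp [linForm]

lemma aeval_linForm {n : ℕ} (z : Fin (n + 1) → ℂ) (a : Fin (n + 1) → ℝ) :
    aeval z (linForm n a) = ∑ j, (a j : ℂ) * z j := by
  simp [linForm, Fintype.linearCombination_apply, map_sum]

lemma linForm_injective (n : ℕ) : Function.Injective (linForm n) := by
  have h : LinearIndependent ℝ (X : Fin (n + 1) → PolyS n) :=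
    MvPolynomial.linearIndependent_X (Fin (n + 1)) ℝ
  exact h.fintypeLinearCombination_injective

lemma range_linForm (n : ℕ) :
    LinearMap.range (linForm n) = homogeneousSubmodule (Fin (n + 1)) ℝ 1 := by
  rw [homogeneousSubmodule_one_eq_span_X, linForm, Fintype.range_linearCombination]

/-- The values of a `ℂ`-linear functional at `z` and at its conjugate, in terms of the real
linear forms given by the real and imaginary parts of its coefficients. -/
lemma aeval_linForm_re_im {n : ℕ} (φ : (Fin (n + 1) → ℂ) →ₗ[ℂ] ℂ) (z : Fin (n + 1) → ℂ) :
    φ z = aeval z (linForm n fun j => (φ (Pi.single j 1)).re) +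
        Complex.I * aeval z (linForm n fun j => (φ (Pi.single j 1)).im) ∧
      conj (φ (star z)) = aeval z (linForm n fun j => (φ (Pi.single j 1)).re) -
        Complex.I * aeval z (linForm n fun j => (φ (Pi.single j 1)).im) := by
  simp only [aeval_linForm, Finset.mul_sum, ← Finset.sum_add_distrib, ← Finset.sum_sub_distrib]
  constructor
  · rw [φ.apply_eq_sum_mul_single]
    refine Finset.sum_congr rfl fun j _ => ?_
    conv_lhs => rw [← Complex.re_add_im (φ (Pi.single j 1))]
    ring
  · rw [φ.apply_eq_sum_mul_single, map_sum]
    refine Finset.sum_congr rfl fun j _ => ?_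
    have hconj : conj (φ (Pi.single j 1)) =
        (φ (Pi.single j 1)).re - Complex.I * (φ (Pi.single j 1)).im := by
      apply Complex.ext <;> simp
    rw [map_mul, hconj]
    simp
    ring

lemma star_mem_VC {n : ℕ} {I : Ideal (PolyS n)} {z : Fin (n + 1) → ℂ} (hz : z ∈ VC I) :
    star z ∈ VC I := by
  intro f hf
  have h : aeval (star z) f = conj (aeval z f) := by
    have := comp_aeval_apply (R := ℝ) z Complex.conjAe.toAlgHom f
    exact this.symm
  rw [h, hz f hf, map_zero]

lemma star_mem_complexify {n : ℕ} {L : Submodule ℝ (Fin (n + 1) → ℝ)} {z : Fin (n + 1) → ℂ}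
    (hz : z ∈ complexify L) : star z ∈ complexify L := by
  induction hz using Submodule.span_induction with
  | mem x hx =>
    obtain ⟨y, hy, rfl⟩ := hx
    refine Submodule.subset_span ⟨y, hy, ?_⟩
    ext i
    simp
  | zero => simp
  | add x y _ _ hx hy => rw [star_add]; exact add_mem hx hy
  | smul c x _ hx => rw [star_smul]; exact Submodule.smul_mem _ _ hx

/-- If the span of `v` is stable under conjugation, it is cut out by real linear forms. -/
lemma mem_span_of_forall_linForm {n : ℕ} {ι : Type*} {v : ι → Fin (n + 1) → ℂ}
    (hconj : ∀ i, star (v i) ∈ Submodule.span ℂ (Set.range v)) {z : Fin (n + 1) → ℂ}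
    (hz : ∀ a, (∀ i, aeval (v i) (linForm n a) = 0) → aeval z (linForm n a) = 0) :
    z ∈ Submodule.span ℂ (Set.range v) := by
  by_contra hzv
  obtain ⟨φ, hφz, hφ⟩ := Submodule.exists_le_ker_of_notMem hzv
  have hv : ∀ i, φ (v i) = 0 := fun i => hφ (Submodule.subset_span ⟨i, rfl⟩)
  have hv' : ∀ i, φ (star (v i)) = 0 := fun i => hφ (hconj i)
  apply hφz
  rw [(aeval_linForm_re_im φ z).1, hz _ fun i => ?_, hz _ fun i => ?_]
  · simp
  · obtain ⟨h₁, h₂⟩ := aeval_linForm_re_im φ (v i)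
    rw [hv] at h₁
    rw [hv', map_zero] at h₂
    have : Complex.I * aeval (v i) (linForm n fun j => (φ (Pi.single j 1)).im) = 0 := by
      linear_combination (h₂ - h₁) / 2
    simpa using this
  · obtain ⟨h₁, h₂⟩ := aeval_linForm_re_im φ (v i)
    rw [hv] at h₁
    rw [hv', map_zero] at h₂
    linear_combination -(h₁ + h₂) / 2

/-- Some real linear form vanishes at none of finitely many nonzero complex points. -/
lemma exists_linForm_forall_ne_zero {n : ℕ} {ι : Type*} [Finite ι] (v : ι → Fin (n + 1) → ℂ)
    (hv : ∀ i, v i ≠ 0) : ∃ a, ∀ i, aeval (v i) (linForm n a) ≠ 0 := by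
  by_contra! H
  obtain ⟨i, hi⟩ := Subspace.exists_eq_top_of_iUnion_eq_univ
    (p := fun i => LinearMap.ker ((aeval (v i)).toLinearMap ∘ₗ linForm n))
    (Set.eq_univ_of_forall fun a => by simpa using H a)
  refine hv i (funext fun k => ?_)
  have : Pi.single k (1 : ℝ) ∈ LinearMap.ker ((aeval (v i)).toLinearMap ∘ₗ linForm n) := by
    rw [hi]; trivial
  simpa [linForm_single] using this

/-- The real linear forms vanishing on the points `v i`. -/
def vanishingForms {n : ℕ} {ι : Type*} (v : ι → Fin (n + 1) → ℂ) :
    Submodule ℝ (Fin (n + 1) → ℝ) :=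
  ⨅ i, LinearMap.ker ((aeval (v i)).toLinearMap ∘ₗ linForm n)

lemma mem_vanishingForms {n : ℕ} {ι : Type*} {v : ι → Fin (n + 1) → ℂ}
    {a : Fin (n + 1) → ℝ} :
    a ∈ vanishingForms v ↔ ∀ i, aeval (v i) (linForm n a) = 0 := by
  simp [vanishingForms]

lemma le_finrank_vanishingForms {n : ℕ} {ι : Type*} {v : ι → Fin (n + 1) → ℂ}
    {L : Submodule ℝ (Fin (n + 1) → ℝ)} (hv : ∀ i, v i ∈ complexify L) :
    n + 1 ≤ Module.finrank ℝ (vanishingForms v) + Module.finrank ℝ L := by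
  let T : (Fin (n + 1) → ℝ) →ₗ[ℝ] Module.Dual ℝ L :=
    (LinearMap.lcomp ℝ ℝ L.subtype) ∘ₗ (dotProductBilin ℝ ℝ)
  have hT : LinearMap.ker T ≤ vanishingForms v := by
    intro a ha
    rw [mem_vanishingForms]
    intro i
    have hle : complexify L ≤
        LinearMap.ker (dotProductBilin ℂ ℂ (fun j => (a j : ℂ))) := by
      refine Submodule.span_le.mpr ?_
      rintro _ ⟨x, hx, rfl⟩
      have h : a ⬝ᵥ x = 0 := LinearMap.congr_fun (LinearMap.mem_ker.mp ha) ⟨x, hx⟩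
      have h' := congrArg (fun t : ℝ => (t : ℂ)) h
      simpa [dotProduct] using h'
    simpa [aeval_linForm, dotProduct] using hle (hv i)
  have h₁ := LinearMap.finrank_range_add_finrank_ker T
  have h₂ := Submodule.finrank_mono hT
  have h₃ := (LinearMap.range T).finrank_le
  rw [Subspace.dual_finrank_eq] at h₃
  rw [Module.finrank_fin_fun] at h₁
  omega

lemma homogeneousComponent_two_mul {σ R : Type*} [CommSemiring R] {w : MvPolynomial σ R}
    (hw : w.IsHomogeneous 1) (r : MvPolynomial σ R) :
    homogeneousComponent 2 (r * w) = homogeneousComponent 1 r * w := by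
  let := MvPolynomial.gradedAlgebra (σ := σ) (R := R)
  have := DirectSum.coe_decompose_mul_add_of_right_mem (homogeneousSubmodule σ R)
    (i := 1) (j := 1) (a := r) hw
  have hd : ∀ (φ : MvPolynomial σ R) (i : ℕ),
      (DirectSum.decompose (homogeneousSubmodule σ R) φ i : MvPolynomial σ R) =
        homogeneousComponent i φ := decomposition.decompose'_apply
  rwa [hd, hd] at this

/-- Quadratic forms in the ideal generated by `h` and the linear forms vanishing on the
points `v i` agree on these points with a multiple of `h`. -/
lemma exists_linForm_of_mem_span {n : ℕ} {ι : Type*} {v : ι → Fin (n + 1) → ℂ}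
    {h : Fin (n + 1) → ℝ} {f : PolyS n}
    (hf : f ∈ Ideal.span
      ((vanishingForms v ⊔ Submodule.span ℝ {h}).map (linForm n) : Set (PolyS n)))
    (hf2 : f.IsHomogeneous 2) :
    ∃ b, ∀ i, aeval (v i) f = aeval (v i) (linForm n h) * aeval (v i) (linForm n b) := by
  suffices H : ∀ r, ∃ b, ∀ i, aeval (v i) (homogeneousComponent 2 (r * f)) =
      aeval (v i) (linForm n h) * aeval (v i) (linForm n b) by
    simpa [homogeneousComponent_eq_self hf2] using H 1
  clear hf2
  induction hf using Submodule.span_induction with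
  | mem w hw =>
    intro r
    obtain ⟨x, hx, rfl⟩ := hw
    obtain ⟨a, ha, y, hy, rfl⟩ := Submodule.mem_sup.mp hx
    obtain ⟨t, rfl⟩ := Submodule.mem_span_singleton.mp hy
    rw [mem_vanishingForms] at ha
    have hr : homogeneousComponent 1 r ∈ LinearMap.range (linForm n) := by
      rw [range_linForm]
      exact homogeneousComponent_mem 1 r
    obtain ⟨b, hb⟩ := hr
    refine ⟨t • b, fun i => ?_⟩
    rw [homogeneousComponent_two_mul, ← hb]
    · simp [ha i]
      ring
    · rw [← mem_homogeneousSubmodule, ← range_linForm]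
      exact ⟨_, rfl⟩
  | zero => exact fun r => ⟨0, by simp⟩
  | add x y _ _ hx hy =>
    intro r
    obtain ⟨b, hb⟩ := hx r
    obtain ⟨c, hc⟩ := hy r
    exact ⟨b + c, fun i => by simp [mul_add, hb i, hc i]⟩
  | smul s x _ hx =>
    intro r
    simpa [mul_assoc] using hx (r * s)

/-- If the relations among pairwise non-proportional vectors are stable under multiplication
by all coordinate functions divided by a nowhere vanishing function, then the vectors are
linearly independent. -/
lemma linearIndependent_of_relations_stable {K ι κ : Type*} [Field K] [Fintype ι] [Fintype κ]
    {v : ι → κ → K} {u : ι → K} (hu : ∀ i, u i ≠ 0) (hv0 : ∀ i, v i ≠ 0)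
    (hdist : ∀ i j, i ≠ j → v j ∉ K ∙ v i)
    (hstable : ∀ c : ι → K, ∑ i, c i • v i = 0 → ∀ k, ∑ i, (c i * v i k * u i) • v i = 0) :
    LinearIndependent K v := by
  classical
  have hφ : ∀ φ : (κ → K) →ₗ[K] K, ∀ c : ι → K, ∑ i, c i • v i = 0 →
      ∑ i, (c i * φ (v i) * u i) • v i = 0 := by
    intro φ c hc
    calc ∑ i, (c i * φ (v i) * u i) • v i
        = ∑ i, ∑ k, φ (Pi.single k 1) • (c i * v i k * u i) • v i := by
          refine Finset.sum_congr rfl fun i _ => ?_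
          rw [φ.apply_eq_sum_mul_single, Finset.mul_sum, Finset.sum_mul, Finset.sum_smul]
          refine Finset.sum_congr rfl fun k _ => ?_
          rw [smul_smul]
          congr 1
          ring
      _ = 0 := by
          rw [Finset.sum_comm]
          refine Finset.sum_eq_zero fun k _ => ?_
          rw [← Finset.smul_sum, hstable c hc k, smul_zero]
  rw [Fintype.linearIndependent_iff]
  intro c hc j
  have hsep : ∀ i, ∃ φ : (κ → K) →ₗ[K] K, i ≠ j → φ (v j) ≠ 0 ∧ φ (v i) = 0 := by
    intro i
    by_cases hij : i = j
    · exact ⟨0, fun h => absurd hij h⟩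
    · obtain ⟨φ, h₁, h₂⟩ := Submodule.exists_le_ker_of_notMem (hdist i j hij)
      exact ⟨φ, fun _ => ⟨h₁, h₂ (Submodule.mem_span_singleton_self _)⟩⟩
  choose φ hsep using hsep
  have hprod : ∀ s : Finset ι, ∑ i, (c i * ∏ k ∈ s, (φ k (v i) * u i)) • v i = 0 := by
    intro s
    induction s using Finset.induction_on with
    | empty => simpa using hc
    | insert a s ha ih =>
      rw [← hφ (φ a) _ ih]
      refine Finset.sum_congr rfl fun i _ => ?_
      rw [Finset.prod_insert ha]
      congr 1
      ring
  have h := hprod (Finset.univ.erase j)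
  rw [Finset.sum_eq_single j] at h
  · rcases smul_eq_zero.mp h with h | h
    · rcases mul_eq_zero.mp h with h | h
      · exact h
      · obtain ⟨k, hk, h⟩ := Finset.prod_eq_zero_iff.mp h
        exact absurd h (mul_ne_zero (hsep k (Finset.ne_of_mem_erase hk)).1 (hu j))
    · exact absurd h (hv0 j)
  · intro i _ hij
    rw [Finset.prod_eq_zero (Finset.mem_erase.mpr ⟨hij, Finset.mem_univ i⟩), mul_zero, zero_smul]
    rw [(hsep i hij).2, zero_mul]
  · exact fun h => absurd (Finset.mem_univ j) h

/-- If `X = V(I)` satisfies the `p`-base-point-free property, then `X` is `p`-small: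
whenever a real linear subspace `L` of dimension at most `p + 1` meets `V(I)` in a finite
union of (distinct) complex lines, vectors spanning these lines are linearly independent. -/
theorem statement1 {n p : ℕ} (hn : 1 ≤ n) (hp : 1 ≤ p) (I : Ideal (PolyS n))
    (hhom : IsHomIdeal I) (hrad : I.IsRadical)
    (hI1 : ∀ f ∈ I, f.IsHomogeneous 1 → f = 0)
    (hbpf : pBPF I p)
    (L : Submodule ℝ (Fin (n + 1) → ℝ)) (hL : Module.finrank ℝ L ≤ p + 1)
    (s : ℕ) (v : Fin s → (Fin (n + 1) → ℂ))
    (hv0 : ∀ i, v i ≠ 0)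
    (hdist : ∀ i j, i ≠ j → (ℂ ∙ v i) ≠ (ℂ ∙ v j))
    (hunion : VC I ∩ (complexify L : Set (Fin (n + 1) → ℂ)) =
      ⋃ i, ((ℂ ∙ v i : Submodule ℂ (Fin (n + 1) → ℂ)) : Set (Fin (n + 1) → ℂ))) :
    LinearIndependent ℂ v := by
  have hmem : ∀ i, v i ∈ VC I ∩ (complexify L : Set (Fin (n + 1) → ℂ)) := fun i => by
    rw [hunion]
    exact Set.mem_iUnion.mpr ⟨i, Submodule.mem_span_singleton_self _⟩
  have hline : ∀ z ∈ VC I, z ∈ complexify L → ∃ i, ∃ t : ℂ, t • v i = z := by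
    intro z hz hzL
    have : z ∈ VC I ∩ (complexify L : Set (Fin (n + 1) → ℂ)) := ⟨hz, hzL⟩
    rw [hunion] at this
    obtain ⟨i, hi⟩ := Set.mem_iUnion.mp this
    exact ⟨i, Submodule.mem_span_singleton.mp hi⟩
  have hconj : ∀ i, star (v i) ∈ Submodule.span ℂ (Set.range v) := by
    intro i
    obtain ⟨j, t, ht⟩ := hline _ (star_mem_VC (hmem i).1) (star_mem_complexify (hmem i).2)
    rw [← ht]
    exact Submodule.smul_mem _ _ (Submodule.subset_span ⟨j, rfl⟩)
  have hspan : Submodule.span ℂ (Set.range v) ≤ complexify L := by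
    rw [Submodule.span_le]
    rintro _ ⟨i, rfl⟩
    exact (hmem i).2
  rcases isEmpty_or_nonempty (Fin s) with hs | ⟨⟨i₀⟩⟩
  · exact linearIndependent_empty_type
  obtain ⟨h, hh⟩ := exists_linForm_forall_ne_zero v hv0
  let A := vanishingForms v ⊔ Submodule.span ℝ {h}
  have hcodim : n + 1 ≤ Module.finrank ℝ (A.map (linForm n)) + p := by
    rw [← (Submodule.equivMapOfInjective _ (linForm_injective n) A).finrank_eq]
    have hlt : vanishingForms v < A := by
      refine lt_of_le_of_ne le_sup_left fun hA => hh i₀ ?_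
      have : h ∈ vanishingForms v := by
        rw [hA]
        exact Submodule.mem_sup_right (Submodule.mem_span_singleton_self h)
      exact mem_vanishingForms.mp this i₀
    have h₁ := Submodule.finrank_lt_finrank_of_lt hlt
    have h₂ := le_finrank_vanishingForms fun i => (hmem i).2
    omega
  have hbase : ∀ z ∈ VC I, z ≠ 0 → ∃ w ∈ A.map (linForm n), aeval z w ≠ 0 := by
    intro z hz hz0
    by_contra! H
    have hzs : z ∈ Submodule.span ℂ (Set.range v) := mem_span_of_forall_linForm hconj
      fun a ha => H _ ⟨a, Submodule.mem_sup_left (mem_vanishingForms.mpr ha), rfl⟩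
    obtain ⟨i, t, rfl⟩ := hline z hz (hspan hzs)
    have h0 := H _ ⟨h, Submodule.mem_sup_right (Submodule.mem_span_singleton_self h), rfl⟩
    have h1 : aeval (t • v i) (linForm n h) = t * aeval (v i) (linForm n h) := by
      simp only [aeval_linForm, Finset.mul_sum, Pi.smul_apply, smul_eq_mul]
      exact Finset.sum_congr rfl fun j _ => by ring
    rw [h1] at h0
    rcases mul_eq_zero.mp h0 with h0 | h0
    · exact hz0 (by rw [h0, zero_smul])
    · exact hh i h0
  have hW : A.map (linForm n) ≤ homogeneousSubmodule (Fin (n + 1)) ℝ 1 := by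
    rw [← range_linForm]
    exact LinearMap.map_le_range
  have hquad : ∀ k l, ∃ b, ∀ i, v i k * v i l =
      aeval (v i) (linForm n h) * aeval (v i) (linForm n b) := by
    intro k l
    have hkl := XX_mem_S2 k l
    obtain ⟨a, haI, ha, hspan⟩ := hbpf _ hW hcodim hbase _ hkl
    obtain ⟨b, hb⟩ := exists_linForm_of_mem_span hspan (hkl.sub ha)
    refine ⟨b, fun i => ?_⟩
    rw [← hb i]
    simp [(hmem i).1 a haI]
  refine linearIndependent_of_relations_stable
    (u := fun i => (aeval (v i) (linForm n h))⁻¹) (fun i => inv_ne_zero (hh i)) hv0 ?_ ?_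
  · intro i j hij hji
    refine hdist j i hij.symm ?_
    obtain ⟨t, ht⟩ := Submodule.mem_span_singleton.mp hji
    have ht0 : t ≠ 0 := fun h0 => hv0 j (by rw [← ht, h0, zero_smul])
    rw [← ht]
    exact Submodule.span_singleton_smul_eq (IsUnit.mk0 t ht0) _
  · intro c hc k
    ext l
    obtain ⟨b, hb⟩ := hquad k l
    have hcb : ∑ i, c i * aeval (v i) (linForm n b) = 0 := by
      have hcj : ∀ j, ∑ i, c i * v i j = 0 := fun j => by simpa using congrFun hc j
      simp only [aeval_linForm, Finset.mul_sum]
      rw [Finset.sum_comm]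
      refine Finset.sum_eq_zero fun j _ => ?_
      rw [← mul_zero (b j : ℂ), ← hcj j, Finset.mul_sum]
      exact Finset.sum_congr rfl fun i _ => by ring
    simp only [Finset.sum_apply, Pi.smul_apply, smul_eq_mul, Pi.zero_apply]
    rw [← hcb]
    refine Finset.sum_congr rfl fun i _ => ?_
    have hi := hh i
    calc _ = c i * (v i k * v i l) * (aeval (v i) (linForm n h))⁻¹ := by ring
      _ = _ := by rw [hb i]; field_simp
end
end

section
/- Let I ⊆ S = ℝ[x_0,…,x_n] be a homogeneous radical ideal with I_1 = 0 that is set-theoretically defined by quadrics, i.e., V(I) = V(J) where J is the ideal generated by I_2. Suppose there is a real linear subspace W ⊆ ℝ^{n+1} of dimension p + 1 (p ≥ 1) such that V(I) ∩ W_ℂ is a finite union of one-dimensional complex subspaces, at least p + 2 of which are spanned by real vectors. Then the Hankel cone Σ*(I) has an extreme ray spanned by some ℓ with 2 ≤ rank(ℓ) ≤ p; in particular the Hankel index of V(I) is at most p. -/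
open MvPolynomial

noncomputable section

open Matrix

/-- The matrix of the bilinear form `B_ℓ` in the basis of the variables. -/
def hankelMatrix (n : ℕ) :
    (S2 n →ₗ[ℝ] ℝ) →ₗ[ℝ] Matrix (Fin (n + 1)) (Fin (n + 1)) ℝ where
  toFun l := Matrix.of fun i j => l ⟨X i * X j, XX_mem_S2 i j⟩
  map_add' _ _ := rfl
  map_smul' _ _ := rfl

lemma hankelMatrix_apply {n : ℕ} (l : S2 n →ₗ[ℝ] ℝ) (i j : Fin (n + 1)) :
    hankelMatrix n l i j = l ⟨X i * X j, XX_mem_S2 i j⟩ := rfl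

lemma hankelMatrix_isHermitian {n : ℕ} (l : S2 n →ₗ[ℝ] ℝ) : (hankelMatrix n l).IsHermitian := by
  ext i j
  simp [hankelMatrix_apply, mul_comm]

/-- The products of two variables span the quadratic forms. -/
lemma S2_eq_span (n : ℕ) :
    S2 n = Submodule.span ℝ (Set.range fun ij : Fin (n + 1) × Fin (n + 1) =>
      (X ij.1 * X ij.2 : PolyS n)) := by
  rw [S2, ← homogeneousSubmodule_one_pow, homogeneousSubmodule_one_eq_span_X, pow_two,
    Submodule.span_mul_span]
  congr 1
  ext q
  simp [Set.mem_mul]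

lemma hankelMatrix_injective (n : ℕ) : Function.Injective (hankelMatrix n) := by
  intro l l' h
  have key : ∀ q (hq : q ∈ Submodule.span ℝ (Set.range
      fun ij : Fin (n + 1) × Fin (n + 1) => (X ij.1 * X ij.2 : PolyS n))),
      ∀ hq' : q ∈ S2 n, l ⟨q, hq'⟩ = l' ⟨q, hq'⟩ := by
    intro q hq
    induction hq using Submodule.span_induction with
    | mem q hq =>
      obtain ⟨⟨i, j⟩, rfl⟩ := hq
      intro _
      exact congrFun (congrFun h i) j
    | zero => intro _; exact (map_zero l).trans (map_zero l').symm
    | add x y hx hy ihx ihy =>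
      intro _
      rw [← S2_eq_span] at hx hy
      have := congrArg₂ (· + ·) (ihx hx) (ihy hy)
      rwa [← map_add, ← map_add] at this
    | smul a x hx ihx =>
      intro _
      rw [← S2_eq_span] at hx
      have := congrArg (a • ·) (ihx hx)
      rwa [← map_smul, ← map_smul] at this
  ext ⟨q, hq⟩
  exact key q (by rwa [← S2_eq_span]) hq

lemma exists_eq_sum_X {n : ℕ} {f : PolyS n} (hf : f.IsHomogeneous 1) :
    ∃ a : Fin (n + 1) → ℝ, f = ∑ i, a i • X i := by
  rw [← mem_homogeneousSubmodule, homogeneousSubmodule_one_eq_span_X,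
    Submodule.mem_span_range_iff_exists_fun] at hf
  obtain ⟨a, rfl⟩ := hf
  exact ⟨a, rfl⟩

lemma isHomogeneous_sum_X {n : ℕ} (a : Fin (n + 1) → ℝ) :
    (∑ i, a i • X i : PolyS n).IsHomogeneous 1 := by
  rw [← mem_homogeneousSubmodule]
  exact Submodule.sum_mem _ fun i _ => Submodule.smul_mem _ _ (isHomogeneous_X ℝ i)

lemma apply_sum_X_mul_self {n : ℕ} (l : S2 n →ₗ[ℝ] ℝ) (a : Fin (n + 1) → ℝ)
    (h : (∑ i, a i • X i : PolyS n) * (∑ i, a i • X i) ∈ S2 n) :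
    l ⟨_, h⟩ = a ⬝ᵥ (hankelMatrix n l *ᵥ a) := by
  have : (⟨_, h⟩ : S2 n) = ∑ i, ∑ j, (a i * a j) • ⟨X i * X j, XX_mem_S2 i j⟩ := by
    ext1
    simp only [Submodule.coe_sum, Submodule.coe_smul, Finset.sum_mul_sum, smul_mul_smul_comm]
  rw [this]
  simp only [map_sum, map_smul, dotProduct, mulVec, hankelMatrix_apply, Finset.mul_sum,
    smul_eq_mul]
  exact Finset.sum_congr rfl fun i _ => Finset.sum_congr rfl fun j _ => by ring

lemma mem_SigmaStar_iff {n : ℕ} {I : Ideal (PolyS n)} {l : S2 n →ₗ[ℝ] ℝ} :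
    l ∈ SigmaStar I ↔
      (∀ q : S2 n, (q : PolyS n) ∈ I → l q = 0) ∧ (hankelMatrix n l).PosSemidef := by
  refine and_congr_right fun _ => ⟨fun h => ?_, fun h f hf => ?_⟩
  · refine .of_dotProduct_mulVec_nonneg (hankelMatrix_isHermitian l) fun a => ?_
    have := h _ (isHomogeneous_sum_X a)
    rwa [apply_sum_X_mul_self] at this
  · obtain ⟨a, rfl⟩ := exists_eq_sum_X hf
    rw [apply_sum_X_mul_self]
    exact h.dotProduct_mulVec_nonneg a

/-- Entries of a positive semidefinite matrix are bounded by its trace. -/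
lemma Matrix.PosSemidef.abs_apply_le_trace {m : Type*} [Fintype m] [DecidableEq m]
    {M : Matrix m m ℝ} (hM : M.PosSemidef) (i j : m) : |M i j| ≤ M.trace := by
  have hsymm : M j i = M i j := by simpa using hM.isHermitian.apply i j
  have hle (k : m) : M k k ≤ M.trace :=
    Finset.single_le_sum (f := fun k => M k k) (fun k _ => hM.diag_nonneg) (Finset.mem_univ k)
  have hplus := hM.dotProduct_mulVec_nonneg (Pi.single i 1 + Pi.single j 1)
  have hminus := hM.dotProduct_mulVec_nonneg (Pi.single i 1 - Pi.single j 1)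
  simp only [star_trivial, mulVec_add, mulVec_sub, mulVec_single_one, add_dotProduct,
    sub_dotProduct, single_one_dotProduct, Pi.add_apply, Pi.sub_apply, col_apply] at hplus hminus
  rw [abs_le]
  constructor <;> linarith [hle i, hle j]

/-- If the Hankel cone contains a nonzero functional whose kernel contains `K`, then it has an
extreme ray with this property: an extreme point of the compact base of trace one functionals. -/
lemma exists_isExtremeIn {n : ℕ} {I : Ideal (PolyS n)} {l₀ : S2 n →ₗ[ℝ] ℝ}
    (hl₀ : l₀ ∈ SigmaStar I) (hne : l₀ ≠ 0) (K : Set (Fin (n + 1) → ℝ))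
    (hK : ∀ k ∈ K, hankelMatrix n l₀ *ᵥ k = 0) :
    ∃ l, IsExtremeIn (SigmaStar I) l ∧ ∀ k ∈ K, hankelMatrix n l *ᵥ k = 0 := by
  let A : Submodule ℝ (S2 n →ₗ[ℝ] ℝ) :=
    { carrier := {l | ∀ q : S2 n, (q : PolyS n) ∈ I → l q = 0}
      add_mem' := fun ha hb q hq => by simp [ha q hq, hb q hq]
      zero_mem' := fun q _ => rfl
      smul_mem' := fun c l hl q hq => by simp [hl q hq] }
  let C : Set (Matrix (Fin (n + 1)) (Fin (n + 1)) ℝ) :=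
    {M | M ∈ A.map (hankelMatrix n) ∧ (∀ a, 0 ≤ a ⬝ᵥ (M *ᵥ a)) ∧ (∀ k ∈ K, M *ᵥ k = 0) ∧
      M.trace = 1}
  have hpsd {l : S2 n →ₗ[ℝ] ℝ} (h : ∀ a, 0 ≤ a ⬝ᵥ (hankelMatrix n l *ᵥ a)) :
      (hankelMatrix n l).PosSemidef :=
    .of_dotProduct_mulVec_nonneg (hankelMatrix_isHermitian l) h
  have hclosed : IsClosed C := by
    have hC : C = (A.map (hankelMatrix n) : Set (Matrix (Fin (n + 1)) (Fin (n + 1)) ℝ)) ∩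
        ((⋂ a : Fin (n + 1) → ℝ, {M | 0 ≤ a ⬝ᵥ (M *ᵥ a)}) ∩
          ((⋂ k ∈ K, {M | M *ᵥ k = 0}) ∩ {M | M.trace = 1})) := by
      ext M
      simp only [C, Set.mem_ofPred_eq, Set.mem_inter_iff, Set.mem_iInter, SetLike.mem_coe]
    have : FiniteDimensional ℝ (A.map (hankelMatrix n)) :=
      FiniteDimensional.finiteDimensional_submodule _
    rw [hC]
    exact (Submodule.closed_of_finiteDimensional _).inter
      ((isClosed_iInter fun a => isClosed_le continuous_const (by fun_prop)).inter
        ((isClosed_iInter fun k => isClosed_iInter fun _ =>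
          isClosed_eq (by fun_prop) continuous_const).inter
            (isClosed_eq continuous_id.matrix_trace continuous_const)))
  have hcompact : IsCompact C := by
    refine (isCompact_univ_pi fun _ => isCompact_univ_pi fun _ =>
      isCompact_Icc (a := (-1 : ℝ)) (b := 1)).of_isClosed_subset hclosed ?_
    rintro _ ⟨⟨l, -, rfl⟩, h, -, htr⟩ i - j -
    have := (hpsd h).abs_apply_le_trace i j
    rw [htr] at this
    exact abs_le.1 this
  have hbase {l : S2 n →ₗ[ℝ] ℝ} (hl : l ∈ SigmaStar I) (hlK : ∀ k ∈ K, hankelMatrix n l *ᵥ k = 0)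
      (htr : (hankelMatrix n l).trace ≠ 0) :
      (hankelMatrix n l).trace⁻¹ • hankelMatrix n l ∈ C := by
    have hM := (mem_SigmaStar_iff.1 hl).2
    refine ⟨Submodule.smul_mem _ _ ⟨l, hl.1, rfl⟩, fun a => ?_, fun k hk => ?_, ?_⟩
    · rw [smul_mulVec, dotProduct_smul]
      exact mul_nonneg (inv_nonneg.2 hM.trace_nonneg) (hM.dotProduct_mulVec_nonneg a)
    · rw [smul_mulVec, hlK k hk, smul_zero]
    · rw [trace_smul, smul_eq_mul, inv_mul_cancel₀ htr]
  have htrace {l : S2 n →ₗ[ℝ] ℝ} (hl : l ∈ SigmaStar I) (h : (hankelMatrix n l).trace = 0) :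
      l = 0 :=
    hankelMatrix_injective n (by
      rw [(mem_SigmaStar_iff.1 hl).2.trace_eq_zero_iff.1 h, map_zero])
  have : LocallyConvexSpace ℝ (Matrix (Fin (n + 1)) (Fin (n + 1)) ℝ) :=
    inferInstanceAs (LocallyConvexSpace ℝ (Fin (n + 1) → Fin (n + 1) → ℝ))
  obtain ⟨M, hM⟩ := hcompact.extremePoints_nonempty
    ⟨_, hbase hl₀ hK fun h => hne (htrace hl₀ h)⟩
  rw [mem_extremePoints] at hM
  obtain ⟨⟨⟨l, hlA, rfl⟩, hnonneg, hlK, htr⟩, hext⟩ := hM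
  refine ⟨l, ⟨mem_SigmaStar_iff.2 ⟨hlA, hpsd hnonneg⟩, ?_, ?_⟩, hlK⟩
  · rintro rfl
    simp at htr
  intro l₁ h₁ l₂ h₂ hsum
  have hM₁ := (mem_SigmaStar_iff.1 h₁).2
  have hM₂ := (mem_SigmaStar_iff.1 h₂).2
  have hMsum : hankelMatrix n l = hankelMatrix n l₁ + hankelMatrix n l₂ := by rw [hsum, map_add]
  have hker (k) (hk : k ∈ K) : hankelMatrix n l₁ *ᵥ k = 0 ∧ hankelMatrix n l₂ *ᵥ k = 0 := by
    have h0 : k ⬝ᵥ (hankelMatrix n l *ᵥ k) = 0 := by rw [hlK k hk, dotProduct_zero]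
    rw [hMsum, add_mulVec, dotProduct_add] at h0
    have n₁ := hM₁.dotProduct_mulVec_nonneg k
    have n₂ := hM₂.dotProduct_mulVec_nonneg k
    rw [star_trivial] at n₁ n₂
    refine ⟨(hM₁.dotProduct_mulVec_zero_iff k).1 ?_, (hM₂.dotProduct_mulVec_zero_iff k).1 ?_⟩ <;>
      rw [star_trivial] <;> linarith
  have htrsum : (hankelMatrix n l₁).trace + (hankelMatrix n l₂).trace = 1 := by
    rw [← trace_add, ← hMsum, htr]
  by_cases t₁ : (hankelMatrix n l₁).trace = 0
  · have := htrace h₁ t₁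
    subst this
    exact ⟨⟨0, le_rfl, by simp⟩, 1, zero_le_one, by simp [hsum]⟩
  by_cases t₂ : (hankelMatrix n l₂).trace = 0
  · have := htrace h₂ t₂
    subst this
    exact ⟨⟨1, zero_le_one, by simp [hsum]⟩, 0, le_rfl, by simp⟩
  obtain ⟨e₁, e₂⟩ := hext _ (hbase h₁ (fun k hk => (hker k hk).1) t₁)
    _ (hbase h₂ (fun k hk => (hker k hk).2) t₂)
    ⟨_, _, lt_of_le_of_ne hM₁.trace_nonneg (Ne.symm t₁),
      lt_of_le_of_ne hM₂.trace_nonneg (Ne.symm t₂), htrsum, by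
      rw [smul_smul, smul_smul, mul_inv_cancel₀ t₁, mul_inv_cancel₀ t₂, one_smul, one_smul,
        hMsum]⟩
  refine ⟨⟨_, hM₁.trace_nonneg, hankelMatrix_injective n ?_⟩,
    ⟨_, hM₂.trace_nonneg, hankelMatrix_injective n ?_⟩⟩
  · rw [map_smul, ← e₁, smul_smul, mul_inv_cancel₀ t₁, one_smul]
  · rw [map_smul, ← e₂, smul_smul, mul_inv_cancel₀ t₂, one_smul]

/-- A nonzero positive semidefinite matrix of rank at most one is `z zᵀ` for some `z ≠ 0`. -/
lemma Matrix.PosSemidef.exists_eq_vecMulVec {m : Type*} [Fintype m] [DecidableEq m]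
    {M : Matrix m m ℝ} (hM : M.PosSemidef) (hne : M ≠ 0) (hrank : M.rank ≤ 1) :
    ∃ z : m → ℝ, z ≠ 0 ∧ M = vecMulVec z z := by
  obtain ⟨i, hi⟩ : ∃ i, M i i ≠ 0 := by
    by_contra! h
    exact hne (hM.trace_eq_zero_iff.1 (Finset.sum_eq_zero fun i _ => h i))
  have hpos : 0 < M i i := lt_of_le_of_ne hM.diag_nonneg hi.symm
  have hsymm (j k : m) : M j k = M k j := by simpa using (hM.isHermitian.apply j k).symm
  obtain ⟨u, hu⟩ := finrank_le_one_iff.1 hrank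
  have hcol (j : m) : ∃ c : ℝ, ∀ k, M k j = c * u.1 k := by
    obtain ⟨c, hc⟩ := hu ⟨M.col j, Pi.single j 1, by simp⟩
    exact ⟨c, fun k => (congrFun (congrArg Subtype.val hc) k).symm⟩
  choose c hc using hcol
  refine ⟨fun k => M k i / √(M i i), fun h => ?_, ?_⟩
  · have := congrFun h i
    simp [hi, hpos.le] at this
  · ext k j
    rw [vecMulVec_apply, div_mul_div_comm, Real.mul_self_sqrt hpos.le, eq_div_iff hi,
      hsymm j i, hc j k, hc i i, hc i k, hc j i]
    ring

/-- Evaluation of quadratic forms at a real vector. -/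
def evalS2 {n : ℕ} (x : Fin (n + 1) → ℝ) : S2 n →ₗ[ℝ] ℝ :=
  (aeval x).toLinearMap.comp (S2 n).subtype

lemma evalS2_apply {n : ℕ} (x : Fin (n + 1) → ℝ) (q : S2 n) :
    evalS2 x q = aeval x (q : PolyS n) := rfl

lemma hankelMatrix_evalS2 {n : ℕ} (x : Fin (n + 1) → ℝ) :
    hankelMatrix n (evalS2 x) = vecMulVec x x := by
  ext i j
  simp [hankelMatrix_apply, evalS2_apply, vecMulVec_apply]

lemma hankelMatrix_evalS2_mulVec {n : ℕ} (x a : Fin (n + 1) → ℝ) :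
    hankelMatrix n (evalS2 x) *ᵥ a = (x ⬝ᵥ a) • x := by
  rw [hankelMatrix_evalS2, vecMulVec_mulVec, op_smul_eq_smul]

/-- A functional of rank at most one in the Hankel cone is evaluation at a real vector. -/
lemma exists_eq_evalS2 {n : ℕ} {I : Ideal (PolyS n)} {l : S2 n →ₗ[ℝ] ℝ}
    (hl : l ∈ SigmaStar I) (hne : l ≠ 0) (hrank : rankL l ≤ 1) :
    ∃ z : Fin (n + 1) → ℝ, z ≠ 0 ∧ l = evalS2 z := by
  obtain ⟨z, hz, h⟩ := (mem_SigmaStar_iff.1 hl).2.exists_eq_vecMulVec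
    (fun h => hne (hankelMatrix_injective n (h.trans (map_zero _).symm))) hrank
  exact ⟨z, hz, hankelMatrix_injective n (h.trans (hankelMatrix_evalS2 z).symm)⟩

/-- A linear relation `x₀ = ∑ cᵢ xᵢ` between zeros of the quadrics in `I`, together with a linear
form `f` such that every `cᵢ f(xᵢ)` is positive, yields a positive semidefinite functional with `f`
in its kernel. -/
lemma exists_mem_SigmaStar_of_relation {n : ℕ} {I : Ideal (PolyS n)} {ι : Type*} {S : Finset ι}
    {x : ι → Fin (n + 1) → ℝ} {x₀ : Fin (n + 1) → ℝ} {c : ι → ℝ} {f : Fin (n + 1) → ℝ}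
    (hx : ∀ i ∈ S, ∀ q : S2 n, (q : PolyS n) ∈ I → evalS2 (x i) q = 0)
    (hx₀ : ∀ q : S2 n, (q : PolyS n) ∈ I → evalS2 x₀ q = 0)
    (hsum : ∑ i ∈ S, c i • x i = x₀)
    (hpos : ∀ i ∈ S, 0 < c i * (x i ⬝ᵥ f))
    (hprop : ∃ i ∈ S, x i ∉ Submodule.span ℝ {x₀}) :
    ∃ l ∈ SigmaStar I, l ≠ 0 ∧ hankelMatrix n l *ᵥ f = 0 ∧
      ∀ w, (∀ i ∈ S, x i ⬝ᵥ w = 0) → hankelMatrix n l *ᵥ w = 0 := by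
  obtain ⟨k, hk, hkx⟩ := hprop
  have hdot (b : Fin (n + 1) → ℝ) : x₀ ⬝ᵥ b = ∑ i ∈ S, c i * (x i ⬝ᵥ b) := by
    rw [← hsum, sum_dotProduct]
    simp
  have hf₀ : 0 < x₀ ⬝ᵥ f := by
    rw [hdot]
    exact Finset.sum_pos hpos ⟨k, hk⟩
  have hfx {i} (hi : i ∈ S) : x i ⬝ᵥ f ≠ 0 := right_ne_zero_of_mul (hpos i hi).ne'
  let a : ι → ℝ := fun i => c i * (x₀ ⬝ᵥ f) / (x i ⬝ᵥ f)
  have ha {i} (hi : i ∈ S) : 0 < a i := by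
    have : a i = c i * (x i ⬝ᵥ f) * (x₀ ⬝ᵥ f) / (x i ⬝ᵥ f) ^ 2 := by
      have := hfx hi
      simp only [a]
      field_simp
    rw [this]
    exact div_pos (mul_pos (hpos i hi) hf₀) (sq_pos_of_ne_zero (hfx hi))
  let l : S2 n →ₗ[ℝ] ℝ := ∑ i ∈ S, a i • evalS2 (x i) - evalS2 x₀
  have hl (b : Fin (n + 1) → ℝ) :
      hankelMatrix n l *ᵥ b = ∑ i ∈ S, (a i * (x i ⬝ᵥ b)) • x i - (x₀ ⬝ᵥ b) • x₀ := by
    simp only [l, map_sub, map_sum, map_smul, sub_mulVec, sum_mulVec, smul_mulVec,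
      hankelMatrix_evalS2_mulVec, smul_smul]
  have hquad (b : Fin (n + 1) → ℝ) :
      b ⬝ᵥ (hankelMatrix n l *ᵥ b) = ∑ i ∈ S, a i * (x i ⬝ᵥ b) ^ 2 - (x₀ ⬝ᵥ b) ^ 2 := by
    rw [hl, dotProduct_sub, dotProduct_sum]
    simp only [dotProduct_smul, smul_eq_mul, pow_two, mul_assoc, dotProduct_comm _ b]
  refine ⟨l, mem_SigmaStar_iff.2 ⟨fun q hq => ?_,
    .of_dotProduct_mulVec_nonneg (hankelMatrix_isHermitian l) fun b => ?_⟩, fun h => ?_, ?_,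
    fun w hw => ?_⟩
  · simp only [l, LinearMap.sub_apply, LinearMap.sum_apply, LinearMap.smul_apply, hx₀ q hq, sub_zero]
    exact Finset.sum_eq_zero fun i hi => by rw [hx i hi q hq, smul_zero]
  · rw [star_trivial, hquad, sub_nonneg, hdot b]
    have hone : ∑ i ∈ S, c i * (x i ⬝ᵥ f) / (x₀ ⬝ᵥ f) = 1 := by
      rw [← Finset.sum_div, ← hdot, div_self hf₀.ne']
    have := Finset.sum_sq_le_sum_mul_sum_of_sq_le_mul S (r := fun i => c i * (x i ⬝ᵥ b))
      (f := fun i => c i * (x i ⬝ᵥ f) / (x₀ ⬝ᵥ f)) (g := fun i => a i * (x i ⬝ᵥ b) ^ 2)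
      (fun i hi => (div_pos (hpos i hi) hf₀).le)
      (fun i hi => mul_nonneg (ha hi).le (sq_nonneg _)) (fun i hi => le_of_eq (by
        have := hfx hi
        have := hf₀.ne'
        simp only [a]
        field_simp))
    rwa [hone, one_mul] at this
  · have hx₀ne : x₀ ≠ 0 := by
      rintro rfl
      simp at hf₀
    let b : Fin (n + 1) → ℝ := (x₀ ⬝ᵥ x₀) • x k - (x₀ ⬝ᵥ x k) • x₀
    have hb₀ : x₀ ⬝ᵥ b = 0 := by
      simp only [b, dotProduct_sub, dotProduct_smul, smul_eq_mul]
      ring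
    have hzero : ∑ i ∈ S, a i * (x i ⬝ᵥ b) ^ 2 = 0 := by
      have := hquad b
      rw [h, map_zero, zero_mulVec, dotProduct_zero, hb₀] at this
      linarith
    have hxb : x k ⬝ᵥ b = 0 := by
      have := (Finset.sum_eq_zero_iff_of_nonneg
        fun i hi => mul_nonneg (ha hi).le (sq_nonneg _)).1 hzero k hk
      simpa [(ha hk).ne'] using this
    have hb : b = 0 := by
      rw [← dotProduct_self_eq_zero]
      nth_rewrite 1 [show b = (x₀ ⬝ᵥ x₀) • x k - (x₀ ⬝ᵥ x k) • x₀ from rfl]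
      rw [sub_dotProduct, smul_dotProduct, smul_dotProduct, hxb, hb₀]
      simp
    refine hkx (Submodule.mem_span_singleton.2 ⟨(x₀ ⬝ᵥ x₀)⁻¹ * (x₀ ⬝ᵥ x k), ?_⟩)
    rw [mul_smul, ← sub_eq_zero.1 hb, smul_smul,
      inv_mul_cancel₀ (mt dotProduct_self_eq_zero.1 hx₀ne), one_smul]
  · rw [hl, ← hsum, Finset.smul_sum, sub_eq_zero]
    refine Finset.sum_congr rfl fun i hi => ?_
    rw [smul_smul, hsum]
    congr 1
    have := hfx hi
    simp only [a]
    field_simp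
  · rw [hl, hdot w, Finset.sum_eq_zero fun i hi => by rw [hw i hi, mul_zero, zero_smul],
      Finset.sum_eq_zero fun i hi => by rw [hw i hi, mul_zero], zero_smul, sub_zero]

/-- The linear form with coefficients `f` vanishes at none of finitely many nonzero complex vectors
for some `f` in any given nonempty open set. -/
lemma exists_mem_open_sum_smul_ne_zero {n s : ℕ} {v : Fin s → Fin (n + 1) → ℂ}
    (hv : ∀ i, v i ≠ 0) {U : Set (Fin (n + 1) → ℝ)} (hU : IsOpen U) (hne : U.Nonempty) :
    ∃ f ∈ U, ∀ i, ∑ j, f j • v i j ≠ 0 := by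
  let L (i : Fin s) : (Fin (n + 1) → ℝ) →ₗ[ℝ] ℂ := Fintype.linearCombination ℝ (v i)
  have hdense (i : Fin s) :
      Dense ((LinearMap.ker (L i) : Set (Fin (n + 1) → ℝ))ᶜ) := by
    rw [← interior_eq_empty_iff_dense_compl, ← Set.not_nonempty_iff_eq_empty]
    intro h
    have htop := Submodule.eq_top_of_nonempty_interior' _ h
    apply hv i
    ext j
    have : L i (Pi.single j 1) = 0 := by
      rw [← LinearMap.mem_ker, htop]
      trivial
    simpa [L] using this
  have hopen (i : Fin s) : IsOpen ((LinearMap.ker (L i) : Set (Fin (n + 1) → ℝ))ᶜ) :=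
    (Submodule.closed_of_finiteDimensional _).isOpen_compl
  obtain ⟨f, hfU, hf⟩ := (dense_iInter_of_isOpen hopen hdense).inter_open_nonempty U hU hne
  refine ⟨f, hfU, fun i => ?_⟩
  have := Set.mem_iInter.1 hf i
  simpa [L, Fintype.linearCombination_apply] using this

/-- Prescribing the values of a linear form on linearly independent vectors. -/
lemma LinearIndependent.exists_dotProduct_eq {m κ : Type*} [Fintype m] [DecidableEq m]
    {x : κ → m → ℝ} (hx : LinearIndependent ℝ x) (c : κ → ℝ) :
    ∃ f : m → ℝ, ∀ i, x i ⬝ᵥ f = c i := by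
  obtain ⟨φ, hφ⟩ := LinearMap.exists_extend ((Module.Basis.span hx).constr ℝ c)
  refine ⟨(dotProductEquiv ℝ m).symm φ, fun i => ?_⟩
  have h₁ : φ (x i) = c i := by
    have := LinearMap.congr_fun hφ (Module.Basis.span hx i)
    rw [Module.Basis.constr_basis] at this
    rw [← this, LinearMap.comp_apply, Submodule.subtype_apply, Module.Basis.span_apply]
  rw [← h₁, dotProduct_comm]
  exact LinearMap.congr_fun ((dotProductEquiv ℝ m).apply_symm_apply φ) (x i)

/-- A vector orthogonal to everything orthogonal to `W` lies in `W`. -/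
lemma Submodule.mem_of_forall_dotProduct_eq_zero {m : Type*} [Fintype m] [DecidableEq m]
    {W : Submodule ℝ (m → ℝ)} {z : m → ℝ}
    (h : ∀ w : m → ℝ, (∀ y ∈ W, y ⬝ᵥ w = 0) → z ⬝ᵥ w = 0) : z ∈ W := by
  by_contra hz
  obtain ⟨φ, hφz, hφW⟩ := Submodule.exists_le_ker_of_notMem hz
  have key (y : m → ℝ) : y ⬝ᵥ (dotProductEquiv ℝ m).symm φ = φ y := by
    rw [dotProduct_comm]
    exact LinearMap.congr_fun ((dotProductEquiv ℝ m).apply_symm_apply φ) y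
  exact hφz ((key z).symm.trans (h _ fun y hy => (key y).trans (hφW hy)))

/-- A real vector in the complexification of `W` lies in `W`. -/
lemma mem_of_ofReal_mem_complexify {n : ℕ} {W : Submodule ℝ (Fin (n + 1) → ℝ)}
    {x : Fin (n + 1) → ℝ} (hx : (fun j => (x j : ℂ)) ∈ complexify W) : x ∈ W := by
  suffices h : ∀ z ∈ complexify W, (fun j => (z j).re) ∈ W ∧ (fun j => (z j).im) ∈ W from
    (h _ hx).1
  intro z hz
  induction hz using Submodule.span_induction with
  | mem z hz =>
    obtain ⟨y, hy, rfl⟩ := hz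
    exact ⟨hy, W.zero_mem⟩
  | zero => exact ⟨W.zero_mem, W.zero_mem⟩
  | add a b _ _ iha ihb => exact ⟨W.add_mem iha.1 ihb.1, W.add_mem iha.2 ihb.2⟩
  | smul c a _ iha =>
    refine ⟨?_, ?_⟩
    · convert W.sub_mem (W.smul_mem c.re iha.1) (W.smul_mem c.im iha.2) using 1
      ext j
      simp
    · convert W.add_mem (W.smul_mem c.re iha.2) (W.smul_mem c.im iha.1) using 1
      ext j
      simp

lemma aeval_ofReal {n : ℕ} (x : Fin (n + 1) → ℝ) (q : PolyS n) :
    aeval (fun j => (x j : ℂ)) q = (aeval x q : ℂ) :=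
  aeval_algebraMap_apply ℂ x q

/-- Rank obstruction from failure of `p`-smallness witnessed by real points: if a real
subspace `W` of dimension `p + 1` meets `V(I)` in finitely many lines, at least `p + 2`
of them real, then `Σ*(I)` has an extreme ray of rank between `2` and `p`. -/
theorem statement5 {n p : ℕ} (hp : 1 ≤ p) (I : Ideal (PolyS n))
    (hhom : IsHomIdeal I) (hrad : I.IsRadical)
    (hI1 : ∀ f ∈ I, f.IsHomogeneous 1 → f = 0)
    (hquad : VC I = { z : Fin (n + 1) → ℂ |
      ∀ q ∈ I, MvPolynomial.IsHomogeneous q 2 → aeval z q = 0 })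
    (W : Submodule ℝ (Fin (n + 1) → ℝ)) (hW : Module.finrank ℝ W = p + 1)
    (s : ℕ) (v : Fin s → (Fin (n + 1) → ℂ))
    (hv0 : ∀ i, v i ≠ 0)
    (hdist : ∀ i j, i ≠ j → (ℂ ∙ v i) ≠ (ℂ ∙ v j))
    (hunion : VC I ∩ (complexify W : Set (Fin (n + 1) → ℂ)) =
      ⋃ i, ((ℂ ∙ v i : Submodule ℂ (Fin (n + 1) → ℂ)) : Set (Fin (n + 1) → ℂ)))
    (T : Finset (Fin s)) (hT : p + 2 ≤ T.card)
    (hreal : ∀ i ∈ T, ∃ x : Fin (n + 1) → ℝ, x ≠ 0 ∧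
      (ℂ ∙ v i) = (ℂ ∙ (fun j => (x j : ℂ)) : Submodule ℂ (Fin (n + 1) → ℂ))) :
    ∃ l : S2 n →ₗ[ℝ] ℝ, IsExtremeIn (SigmaStar I) l ∧ 2 ≤ rankL l ∧ rankL l ≤ p := by
  classical
  choose! x hx₀ hspan using hreal
  have hline (i : Fin s) : ((ℂ ∙ v i : Submodule ℂ (Fin (n + 1) → ℂ)) : Set (Fin (n + 1) → ℂ)) ⊆
      VC I ∩ (complexify W : Set (Fin (n + 1) → ℂ)) := by
    rw [hunion]
    exact Set.subset_iUnion_of_subset i le_rfl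
  have hxmem {i : Fin s} (hi : i ∈ T) : (fun j => (x i j : ℂ)) ∈
      VC I ∩ (complexify W : Set (Fin (n + 1) → ℂ)) :=
    hline i (by rw [hspan i hi]; exact Submodule.mem_span_singleton_self _)
  have hxW {i : Fin s} (hi : i ∈ T) : x i ∈ W := mem_of_ofReal_mem_complexify (hxmem hi).2
  have hxI {i : Fin s} (hi : i ∈ T) (q : S2 n) (hq : (q : PolyS n) ∈ I) :
      evalS2 (x i) q = 0 := by
    have := (hxmem hi).1 q hq
    rwa [aeval_ofReal, Complex.ofReal_eq_zero] at this
  have hprop {i j : Fin s} (hi : i ∈ T) (hj : j ∈ T) (hij : i ≠ j) :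
      x i ∉ Submodule.span ℝ {x j} := by
    intro h
    obtain ⟨r, hr⟩ := Submodule.mem_span_singleton.1 h
    have hr₀ : r ≠ 0 := by
      rintro rfl
      exact hx₀ i hi (by rw [← hr, zero_smul])
    apply hdist i j hij
    rw [hspan i hi, hspan j hj, ← Submodule.span_singleton_smul_eq
      (Complex.ofReal_ne_zero.2 hr₀).isUnit (fun k => (x j k : ℂ))]
    congr 2
    ext k
    simp [← hr]
  -- a real point that depends linearly on some of the others
  obtain ⟨κ, a, hainj, haspan, hli⟩ := exists_linearIndependent' ℝ (fun i : T => x i)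
  have : Finite κ := Finite.of_injective a hainj
  have := Fintype.ofFinite κ
  have hcard : Fintype.card κ ≤ p + 1 := by
    rw [← finrank_span_eq_card hli, ← hW]
    refine Submodule.finrank_mono (Submodule.span_le.2 ?_)
    rintro _ ⟨i, rfl⟩
    exact hxW (a i).2
  obtain ⟨i₀, hi₀⟩ : ∃ i₀, ∀ k, a k ≠ i₀ := by
    by_contra! h
    have := Fintype.card_le_of_surjective a h
    rw [Fintype.card_coe] at this
    omega
  have hdep : x i₀ ∈ Submodule.span ℝ (Set.range ((fun i : T => x i) ∘ a)) := by
    rw [haspan]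
    exact Submodule.subset_span ⟨i₀, rfl⟩
  obtain ⟨c, hc⟩ := (Submodule.mem_span_range_iff_exists_fun ℝ).1 hdep
  let S : Finset κ := Finset.univ.filter fun k => c k ≠ 0
  have hS {k : κ} : k ∈ S ↔ c k ≠ 0 := by simp [S]
  have hcS : ∑ k ∈ S, c k • x (a k) = x i₀ := by
    rw [← hc]
    refine Finset.sum_subset (Finset.subset_univ _) fun k _ hk => ?_
    rw [not_not.1 (mt hS.2 hk), zero_smul]
  obtain ⟨k₀, hk₀⟩ : S.Nonempty := by
    rw [Finset.nonempty_iff_ne_empty]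
    intro h
    rw [h, Finset.sum_empty] at hcS
    exact hx₀ i₀ i₀.2 hcS.symm
  -- a generic linear form
  obtain ⟨f₀, hf₀⟩ := hli.exists_dotProduct_eq c
  obtain ⟨f, hfU, hfv⟩ := exists_mem_open_sum_smul_ne_zero hv0
    (U := ⋂ k ∈ S, {f | 0 < c k * (x (a k) ⬝ᵥ f)})
    (isOpen_biInter_finset fun k _ => isOpen_lt continuous_const (by fun_prop))
    ⟨f₀, Set.mem_iInter₂.2 fun k hk => by
      have : x (a k) ⬝ᵥ f₀ = c k := hf₀ k
      simpa [this] using hS.1 hk⟩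
  have hpos (k) (hk : k ∈ S) : 0 < c k * (x (a k) ⬝ᵥ f) := Set.mem_iInter₂.1 hfU k hk
  have hfz (z : Fin (n + 1) → ℝ) (hz : z ≠ 0) (hzW : z ∈ W)
      (hzI : (fun j => (z j : ℂ)) ∈ VC I) : z ⬝ᵥ f ≠ 0 := by
    have hzU : (fun j => (z j : ℂ)) ∈ VC I ∩ (complexify W : Set (Fin (n + 1) → ℂ)) :=
      ⟨hzI, Submodule.subset_span ⟨z, hzW, rfl⟩⟩
    rw [hunion] at hzU
    obtain ⟨i, hi⟩ := Set.mem_iUnion.1 hzU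
    obtain ⟨α, hα⟩ := Submodule.mem_span_singleton.1 hi
    intro h0
    have hsum : α * ∑ j, f j • v i j = ((z ⬝ᵥ f : ℝ) : ℂ) := by
      rw [dotProduct, Complex.ofReal_sum, Finset.mul_sum]
      refine Finset.sum_congr rfl fun j _ => ?_
      rw [Complex.ofReal_mul, ← congrFun hα j, Pi.smul_apply, smul_eq_mul, Complex.real_smul]
      ring
    rw [h0, Complex.ofReal_zero, mul_eq_zero, or_iff_left (hfv i)] at hsum
    apply hz
    ext j
    have := congrFun hα j
    rw [hsum, zero_smul] at this
    exact Complex.ofReal_eq_zero.1 this.symm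
  obtain ⟨l₀, hl₀, hne, hker, hkerW⟩ := exists_mem_SigmaStar_of_relation (I := I)
    (x := fun k => x (a k)) (fun k _ => hxI (a k).2) (hxI i₀.2) hcS hpos
    ⟨k₀, hk₀, hprop (a k₀).2 i₀.2 fun h => hi₀ k₀ (Subtype.ext h)⟩
  obtain ⟨l, hl, hlK⟩ := exists_isExtremeIn hl₀ hne (insert f {w | ∀ y ∈ W, y ⬝ᵥ w = 0}) (by
    rintro w (rfl | hw)
    · exact hker
    · exact hkerW w fun k _ => hw _ (hxW (a k).2))
  have hlf : hankelMatrix n l *ᵥ f = 0 := hlK f (Set.mem_insert _ _)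
  have hlW (w : Fin (n + 1) → ℝ) (hw : ∀ y ∈ W, y ⬝ᵥ w = 0) : hankelMatrix n l *ᵥ w = 0 :=
    hlK w (Set.mem_insert_of_mem _ hw)
  refine ⟨l, hl, ?_, ?_⟩
  · by_contra! hrank
    obtain ⟨z, hz, hlz⟩ := exists_eq_evalS2 hl.1 hl.2.1 (Nat.lt_succ_iff.1 hrank)
    have hdot (w : Fin (n + 1) → ℝ) (hw : hankelMatrix n l *ᵥ w = 0) : z ⬝ᵥ w = 0 := by
      rw [hlz, hankelMatrix_evalS2_mulVec] at hw
      exact (smul_eq_zero.1 hw).resolve_right hz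
    refine hfz z hz (Submodule.mem_of_forall_dotProduct_eq_zero fun w hw => hdot w (hlW w hw)) ?_
      (hdot f hlf)
    rw [hquad]
    intro q hq hq2
    have := hl.1.1 ⟨q, hq2⟩ hq
    rw [hlz, evalS2_apply] at this
    rw [aeval_ofReal, this, Complex.ofReal_zero]
  · have hsymm (b w : Fin (n + 1) → ℝ) (hw : hankelMatrix n l *ᵥ w = 0) :
        (hankelMatrix n l *ᵥ b) ⬝ᵥ w = 0 := by
      have htr : (hankelMatrix n l)ᵀ = hankelMatrix n l := hankelMatrix_isHermitian l
      rw [dotProduct_comm, dotProduct_mulVec, ← mulVec_transpose, htr, hw, zero_dotProduct]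
    have hle : LinearMap.range (hankelMatrix n l).mulVecLin ≤ W := by
      rintro _ ⟨b, rfl⟩
      exact Submodule.mem_of_forall_dotProduct_eq_zero fun w hw => hsymm b w (hlW w hw)
    have hlt : LinearMap.range (hankelMatrix n l).mulVecLin < W := by
      refine lt_of_le_of_ne hle fun h => ?_
      have hx : x i₀ ∈ LinearMap.range (hankelMatrix n l).mulVecLin := h ▸ hxW i₀.2
      obtain ⟨b, hb⟩ := hx
      refine hfz _ (hx₀ i₀ i₀.2) (hxW i₀.2) (hxmem i₀.2).1 ?_
      rw [← hb]
      exact hsymm b f hlf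
    have := Submodule.finrank_lt_finrank_of_lt hlt
    rw [hW] at this
    exact Nat.lt_succ_iff.1 this
end
end
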